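/- The image of Ω₂ under the embedding p ↦ (T(p), T(C ∖ p)) is a discrete and open subspace of its closure Ω̄₂ in (Set W) × (Set W). -/

import Mathlib

open Set MeasureTheory Filter Topology

/-- The binary Cantor space. -/
abbrev CantorC : Type := ℕ → Bool

/-- Finite binary words. -/
abbrev BWord : Type := List Bool

/-- Prepend a finite word to an infinite binary sequence. -/
def wordApp (w : BWord) (x : CantorC) : CantorC := fun n =>
  if h : n < w.length then w.get ⟨n, h⟩ else x (n - w.length)

/-- The cylinder of sequences beginning with the word `w`. -/
def cyl (w : BWord) : Set CantorC := Set.range (wordApp w)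

/-- `J` is a code: both the α-cylinders and the β-cylinders form a partition of the
Cantor space (every point lies in the cylinder of exactly one pair). -/
def IsCode (J : Finset (BWord × BWord)) : Prop :=
  (∀ x : CantorC, ∃! p : BWord × BWord, p ∈ J ∧ x ∈ cyl p.1) ∧
  (∀ x : CantorC, ∃! p : BWord × BWord, p ∈ J ∧ x ∈ cyl p.2)

/-- `J` is order preserving: α ≺ α' lexicographically iff β ≺ β' lexicographically. -/
def OrdPres (J : Finset (BWord × BWord)) : Prop :=
  ∀ p ∈ J, ∀ q ∈ J, (List.Lex (· < ·) p.1 q.1 ↔ List.Lex (· < ·) p.2 q.2)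

/-- The bijection `g` is induced by the code `J` : it maps `β·x` to `α·x`. -/
def InducedBy (J : Finset (BWord × BWord)) (g : Equiv.Perm CantorC) : Prop :=
  ∀ p ∈ J, ∀ x : CantorC, g (wordApp p.2 x) = wordApp p.1 x

/-- `J` is an order-preserving code inducing the bijection `g`. -/
def IsCodeFor (J : Finset (BWord × BWord)) (g : Equiv.Perm CantorC) : Prop :=
  IsCode J ∧ OrdPres J ∧ InducedBy J g

/-- Membership in (the realization on the Cantor space of) Thompson's group `F`. -/
def InF (g : Equiv.Perm CantorC) : Prop := ∃ J, IsCodeFor J g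

/-- The pair `(α, β)` has `|α| ≡ |β| (mod 2)`. -/
def EvenPair (p : BWord × BWord) : Prop := p.1.length % 2 = p.2.length % 2

/-- Membership in the subgroup `H₂` : some order-preserving code for `g` has all
pairs of even length difference. -/
def InH2 (g : Equiv.Perm CantorC) : Prop :=
  ∃ J, IsCodeFor J g ∧ ∀ p ∈ J, EvenPair p

/-- The union of the α-cylinders over pairs of even length difference. -/
def pSet (J : Finset (BWord × BWord)) : Set CantorC :=
  {x | ∃ p ∈ J, EvenPair p ∧ x ∈ cyl p.1}

/-- The union of the β-cylinders over pairs of even length difference. -/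
def eSet (J : Finset (BWord × BWord)) : Set CantorC :=
  {x | ∃ p ∈ J, EvenPair p ∧ x ∈ cyl p.2}

/-- `p_f` : for `f ∈ F` this equals `pSet J` for any (equivalently, every)
order-preserving code `J` for `f`. -/
def pF (g : Equiv.Perm CantorC) : Set CantorC :=
  ⋃ J ∈ {J : Finset (BWord × BWord) | IsCodeFor J g}, pSet J

/-- `E_f` : for `f ∈ F` this equals `eSet J` for any (equivalently, every)
order-preserving code `J` for `f`. -/
def EF (g : Equiv.Perm CantorC) : Set CantorC :=
  ⋃ J ∈ {J : Finset (BWord × BWord) | IsCodeFor J g}, eSet J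

/-- `Ω₂ = {p_f : f ∈ F}`. -/
def Omega2 : Set (Set CantorC) := {p | ∃ g, InF g ∧ pF g = p}

/-- The action `f · p = f(p ∩ E_f) ∪ f((C ∖ p) ∩ (C ∖ E_f))`. -/
def actF (g : Equiv.Perm CantorC) (p : Set CantorC) : Set CantorC :=
  g '' (p ∩ EF g) ∪ g '' (pᶜ ∩ (EF g)ᶜ)

open Classical in
/-- `T(p)` as a Boolean-valued characteristic function: `T(p) w = true` iff the
cylinder of `w` meets `p`. -/
noncomputable def Tb (p : Set CantorC) : BWord → Bool :=
  fun w => if (cyl w ∩ p).Nonempty then true else false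

/-- The embedding `p ↦ (T(p), T(C ∖ p))`. -/
noncomputable def embedT (p : Set CantorC) : (BWord → Bool) × (BWord → Bool) :=
  (Tb p, Tb pᶜ)

/-- `Ω̄₂` : the closure of the image of `Ω₂` under the embedding. -/
noncomputable def OmegaBar : Set ((BWord → Bool) × (BWord → Bool)) :=
  closure (embedT '' Omega2)

theorem wordApp_append (u v : BWord) (z : CantorC) :
    wordApp (u ++ v) z = wordApp u (wordApp v z) := by
  funext n
  simp only [wordApp, List.length_append, List.get_eq_getElem, List.getElem_append]
  split_ifs <;> first | rfl | omega | (congr 1; omega)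

theorem wordApp_apply_length (w : BWord) (z : CantorC) : wordApp w z w.length = z 0 := by
  simp [wordApp]

theorem wordApp_apply_of_lt (w : BWord) (z : CantorC) {n : ℕ} (h : n < w.length) :
    wordApp w z n = w[n] := by
  simp [wordApp, h]

theorem wordApp_injective : Function.Injective wordApp := by
  have length_le (u v : BWord) (h : wordApp u = wordApp v) : v.length ≤ u.length := by
    by_contra! hlt
    have key (z : CantorC) : z 0 = v[u.length] := by
      rw [← wordApp_apply_length u z, h, wordApp_apply_of_lt v z hlt]
    exact absurd ((key fun _ => true).trans (key fun _ => false).symm) (by decide)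
  intro u v h
  refine List.ext_getElem (le_antisymm (length_le v u h.symm) (length_le u v h)) fun n hu hv => ?_
  rw [← wordApp_apply_of_lt u (fun _ => true) hu, h, wordApp_apply_of_lt v _ hv]

theorem exists_eq_append_of_mem_cyl {u v : BWord} {x : CantorC} (hu : x ∈ cyl u) (hv : x ∈ cyl v)
    (h : u.length ≤ v.length) : ∃ w, v = u ++ w := by
  obtain ⟨y, rfl⟩ := hu
  obtain ⟨z, hz⟩ := hv
  have hpre : u <+: v := by
    rw [List.prefix_iff_getElem]
    refine ⟨h, fun n hn => ?_⟩
    rw [← wordApp_apply_of_lt u y hn, ← hz, wordApp_apply_of_lt v z]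
  exact hpre.imp fun w hw => hw.symm

/-- The parity of a pair of a code is determined by the induced bijection. -/
theorem InducedBy.evenPair_iff {J K : Finset (BWord × BWord)} {g : Equiv.Perm CantorC}
    (hJ : InducedBy J g) (hK : InducedBy K g) {p q : BWord × BWord} (hp : p ∈ J) (hq : q ∈ K)
    {x : CantorC} (hxp : x ∈ cyl p.1) (hxq : x ∈ cyl q.1) : EvenPair p ↔ EvenPair q := by
  wlog h : p.1.length ≤ q.1.length generalizing J K p q
  · exact (this hK hJ hq hp hxq hxp (le_of_not_ge h)).symm
  obtain ⟨w, hw⟩ := exists_eq_append_of_mem_cyl hxp hxq h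
  have h2 : q.2 = p.2 ++ w := wordApp_injective <| funext fun z => g.injective <| by
    rw [hK q hq, wordApp_append, hJ p hp, hw, wordApp_append]
  simp only [EvenPair, hw, h2, List.length_append]
  omega

theorem cyl_subset_pF_or_compl {J : Finset (BWord × BWord)} {g : Equiv.Perm CantorC}
    (hJ : IsCodeFor J g) {p : BWord × BWord} (hp : p ∈ J) :
    cyl p.1 ⊆ pF g ∨ cyl p.1 ⊆ (pF g)ᶜ := by
  by_cases he : EvenPair p
  · exact .inl fun x hx => mem_biUnion (mem_ofPred.2 hJ) ⟨p, hp, he, hx⟩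
  · refine .inr fun x hx hxg => he ?_
    obtain ⟨K, hK, q, hq, hqe, hxq⟩ := mem_iUnion₂.1 hxg
    exact (hJ.2.2.evenPair_iff hK.2.2 hp hq hx hxq).2 hqe

theorem subset_compl_of_Tb_eq {p q : Set CantorC} {w : BWord} (h : Tb q w = Tb p w)
    (hp : cyl w ⊆ pᶜ) : cyl w ⊆ qᶜ := by
  intro x hx hxq
  have hq : Tb q w = true := if_pos ⟨x, hx, hxq⟩
  have hp' : Tb p w = false := by
    refine (if_neg ?_).trans rfl
    rintro ⟨y, hy, hyp⟩
    exact hp hy hyp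
  simp [hq, hp'] at h

theorem exists_isOpen_embedT_eq {p : Set CantorC} (hp : p ∈ Omega2) :
    ∃ U : Set ((BWord → Bool) × (BWord → Bool)),
      IsOpen U ∧ embedT p ∈ U ∧ ∀ q, embedT q ∈ U → q = p := by
  obtain ⟨g, ⟨J, hJ⟩, rfl⟩ := hp
  refine ⟨⋂ j ∈ J, {z | z.1 j.1 = Tb (pF g) j.1} ∩ {z | z.2 j.1 = Tb (pF g)ᶜ j.1}, ?_, ?_, ?_⟩
  · refine isOpen_biInter_finset fun j _ => IsOpen.inter ?_ ?_
    · exact (isOpen_discrete {Tb (pF g) j.1}).preimage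
        ((continuous_apply (A := fun _ => Bool) j.1).comp continuous_fst)
    · exact (isOpen_discrete {Tb (pF g)ᶜ j.1}).preimage
        ((continuous_apply (A := fun _ => Bool) j.1).comp continuous_snd)
  · simp [embedT]
  · intro q hq
    ext x
    obtain ⟨j, ⟨hj, hx⟩, -⟩ := hJ.1.1 x
    obtain ⟨h1, h2⟩ := mem_iInter₂.1 hq j hj
    rcases cyl_subset_pF_or_compl hJ hj with h | h
    · have hxq := subset_compl_of_Tb_eq h2 (by rwa [compl_compl]) hx
      rw [compl_compl] at hxq
      exact iff_of_true hxq (h hx)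
    · exact iff_of_false (subset_compl_of_Tb_eq h1 h hx) (h hx)

/-- the image of `Ω₂` under `p ↦ (T(p), T(C∖p))` is a discrete and
open subspace of its closure `Ω̄₂`. -/
theorem stmt15 :
    DiscreteTopology ↥(embedT '' Omega2) ∧
    IsOpen {x : ↥OmegaBar | (x : (BWord → Bool) × (BWord → Bool)) ∈ embedT '' Omega2} := by
  constructor
  · rw [discreteTopology_subtype_iff']
    rintro _ ⟨p, hp, rfl⟩
    obtain ⟨U, hU, hpU, huniq⟩ := exists_isOpen_embedT_eq hp
    refine ⟨U, hU, Subset.antisymm ?_ (singleton_subset_iff.2 ⟨hpU, p, hp, rfl⟩)⟩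
    rintro _ ⟨hq, q, -, rfl⟩
    rw [huniq q hq, mem_singleton_iff]
  · rw [isOpen_iff_mem_nhds]
    rintro ⟨_, hx⟩ ⟨p, hp, rfl⟩
    obtain ⟨U, hU, hpU, huniq⟩ := exists_isOpen_embedT_eq hp
    filter_upwards [(hU.preimage continuous_subtype_val).mem_nhds hpU]
    rintro ⟨y, hy⟩ hyU
    have hsub : U ∩ embedT '' Omega2 ⊆ {embedT p} := by
      rintro _ ⟨hq, q, -, rfl⟩
      rw [huniq q hq, mem_singleton_iff]
    have hy' : y ∈ closure {embedT p} :=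
      closure_mono hsub (hU.inter_closure ⟨hyU, hy⟩)
    rw [closure_singleton, mem_singleton_iff] at hy'
    exact ⟨p, hp, hy'.symm⟩
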